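/- arXiv:1607.04425 — 2 statements merged into one kernel-verified Lean document; each statement's English description precedes it below -/
import Mathlib

section
/- Let K be a field of characteristic 0, δ a derivation on K with field of constants F, and f ∈ K[t;δ] of degree m ≥ 2 such that B = Nuc_r(S_f) is a central simple algebra of degree m over F. Let L/K be a field extension to which δ extends, with constant field C, such that L = K·C is a constant extension of K. Then C splits B if and only if f has a left or right linear factor over L, i.e. f = (t − a)·g(t) or f = g(t)·(t − a) in L[t;δ] for some a ∈ L. In particular, in that case S_f ⊗_F C has right nucleus Mat_m(C). -/
open scoped TensorProduct

/-! ## A framework for differential polynomial rings `K[t;δ]` and Petit algebras `S_f`. -/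

/-- A derivation on a field `K`: an additive map satisfying the Leibniz rule. -/
structure Der (K : Type) [Field K] where
  toFun : K → K
  map_add' : ∀ a b : K, toFun (a + b) = toFun a + toFun b
  leibniz' : ∀ a b : K, toFun (a * b) = a * toFun b + toFun a * b

/-- `F` (given as a subfield of `K` via `algebraMap F K`) is precisely the field of
constants `Const(δ) = {a ∈ K | δ(a) = 0}` of the derivation `δ`. -/
def Der.HasConstants {K : Type} [Field K] (δ : Der K) (F : Type) [Field F]
    [Algebra F K] : Prop :=
  ∀ a : K, δ.toFun a = 0 ↔ ∃ c : F, algebraMap F K c = a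

/-- The map `V_p(b) = b^p + δ^{p-1}(b)`. -/
def Der.Vp {K : Type} [Field K] (δ : Der K) (p : ℕ) (b : K) : K :=
  b ^ p + δ.toFun^[p - 1] b

/-- The `e`-fold iterate `V_{p^e}` of `V_p`. -/
def Der.VpIter {K : Type} [Field K] (δ : Der K) (p e : ℕ) : K → K :=
  (δ.Vp p)^[e]

/-- A realization of the differential polynomial ring `R = K[t;δ]`: a ring `R`
together with an embedding `i : K → R` and an element `t` satisfying the
twist relation `t·a = a·t + δ(a)`, such that every element of `R` is *uniquely*
a left `K`-linear combination of the powers `t^n` (witnessed by the coefficient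
function `coeff`), and such that `R` admits a right division algorithm. -/
structure DiffPolyRing (K : Type) [Field K] (δ : Der K) (R : Type) [Ring R] where
  i : K →+* R
  t : R
  coeff : R → (ℕ →₀ K)
  t_mul : ∀ a : K, t * i a = i a * t + i (δ.toFun a)
  repr' : ∀ x : R, x = (coeff x).sum fun n a => i a * t ^ n
  coeff_unique : ∀ (x : R) (c : ℕ →₀ K), x = (c.sum fun n a => i a * t ^ n) → c = coeff x
  rightDiv : ∀ f x : R, f ≠ 0 → ∃! r : R,
    (∃ q : R, x = q * f + r) ∧ (coeff r).support.max < (coeff f).support.max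

namespace DiffPolyRing

variable {K : Type} [Field K] {δ : Der K} {R : Type} [Ring R]

/-- The degree of a differential polynomial, with `deg 0 = ⊥`. -/
def deg (D : DiffPolyRing K δ R) (x : R) : WithBot ℕ := (D.coeff x).support.max

lemma coeff_zero (D : DiffPolyRing K δ R) : D.coeff 0 = 0 :=
  (D.coeff_unique 0 0 (by simp)).symm

lemma deg_zero (D : DiffPolyRing K δ R) : D.deg 0 = ⊥ := by
  simp [deg, D.coeff_zero]

lemma coeff_add (D : DiffPolyRing K δ R) (x y : R) :
    D.coeff (x + y) = D.coeff x + D.coeff y := by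
  refine (D.coeff_unique _ _ ?_).symm
  rw [Finsupp.sum_add_index' (by simp) (by intro n a b; rw [map_add, add_mul])]
  conv_lhs => rw [D.repr' x, D.repr' y]

lemma coeff_neg (D : DiffPolyRing K δ R) (x : R) : D.coeff (-x) = -D.coeff x := by
  have h := D.coeff_add (-x) x
  rw [neg_add_cancel, D.coeff_zero] at h
  exact eq_neg_of_add_eq_zero_left h.symm

lemma deg_neg (D : DiffPolyRing K δ R) (x : R) : D.deg (-x) = D.deg x := by
  simp [deg, D.coeff_neg]

lemma deg_add_lt (D : DiffPolyRing K δ R) {x y : R} {n : WithBot ℕ}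
    (hx : D.deg x < n) (hy : D.deg y < n) : D.deg (x + y) < n := by
  have hsub : (D.coeff (x + y)).support ⊆ (D.coeff x).support ∪ (D.coeff y).support := by
    rw [D.coeff_add]; exact Finsupp.support_add
  calc D.deg (x + y) ≤ ((D.coeff x).support ∪ (D.coeff y).support).max :=
        Finset.max_mono hsub
    _ = max (D.deg x) (D.deg y) := Finset.max_union
    _ < n := max_lt hx hy

lemma coeff_smul (D : DiffPolyRing K δ R) (c : K) (x : R) :
    D.coeff (D.i c * x) = c • D.coeff x := by
  refine (D.coeff_unique _ _ ?_).symm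
  rw [Finsupp.sum_smul_index (by simp)]
  conv_lhs => rw [D.repr' x, Finsupp.mul_sum]
  exact Finsupp.sum_congr fun n _ => by rw [← mul_assoc, ← map_mul]

lemma deg_i_mul_lt (D : DiffPolyRing K δ R) (c : K) {x : R} {n : WithBot ℕ}
    (hx : D.deg x < n) : D.deg (D.i c * x) < n := by
  have hsub : (D.coeff (D.i c * x)).support ⊆ (D.coeff x).support := by
    rw [D.coeff_smul]; exact Finsupp.support_smul
  exact lt_of_le_of_lt (Finset.max_mono hsub) hx

/-- The additive subgroup of `R` consisting of the differential polynomials of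
degree `< m`; this is the underlying set of the Petit algebra `S_f` for `deg f = m`. -/
def res (D : DiffPolyRing K δ R) (m : ℕ) : AddSubgroup R where
  carrier := {x | D.deg x < (m : WithBot ℕ)}
  add_mem' hx hy := D.deg_add_lt hx hy
  zero_mem' := by
    show D.deg 0 < (m : WithBot ℕ)
    rw [D.deg_zero]
    exact bot_lt_iff_ne_bot.2 (by simp)
  neg_mem' {x} hx := by
    show D.deg (-x) < (m : WithBot ℕ)
    rw [D.deg_neg]; exact hx

/-- The underlying set `{g ∈ K[t;δ] | deg g < m}` of the Petit algebra `S_f`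
(for `f` of degree `m`), viewed as a subset of `R = K[t;δ]`. -/
def SfSet (D : DiffPolyRing K δ R) (m : ℕ) : Set R := {x | D.deg x < (m : WithBot ℕ)}

/-- The underlying `F`-vector space of the Petit algebra `S_f`, for `f` of degree `m`. -/
abbrev Rlt (D : DiffPolyRing K δ R) (m : ℕ) : Type := ↥(D.res m)

instance instSMul {F : Type} [Field F] [Algebra F K] (D : DiffPolyRing K δ R) (m : ℕ) :
    SMul F (D.Rlt m) :=
  ⟨fun c x => ⟨D.i (algebraMap F K c) * (x : R), D.deg_i_mul_lt _ x.2⟩⟩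

lemma smul_coe {F : Type} [Field F] [Algebra F K] (D : DiffPolyRing K δ R) (m : ℕ)
    (c : F) (x : D.Rlt m) : ((c • x : D.Rlt m) : R) = D.i (algebraMap F K c) * (x : R) := rfl

/-- The `F`-vector space structure of the Petit algebra (where `F ⊆ K` is the field
of constants): `c • x = i(c)·x`. -/
instance instModule {F : Type} [Field F] [Algebra F K] (D : DiffPolyRing K δ R) (m : ℕ) :
    Module F (D.Rlt m) where
  one_smul x := Subtype.ext <| by rw [smul_coe]; simp
  mul_smul a b x := Subtype.ext <| by rw [smul_coe, smul_coe, smul_coe]; simp [mul_assoc]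
  smul_zero a := Subtype.ext <| by rw [smul_coe]; simp
  smul_add a x y := Subtype.ext <| by
    rw [smul_coe]
    push_cast
    rw [smul_coe, smul_coe, mul_add]
  add_smul a b x := Subtype.ext <| by
    push_cast
    rw [smul_coe, smul_coe, smul_coe]
    simp [add_mul]
  zero_smul x := Subtype.ext <| by rw [smul_coe]; simp

open Classical in
/-- The remainder `mod_r f` of right division by `f`. -/
noncomputable def modr (D : DiffPolyRing K δ R) (f x : R) : R :=
  if h : ∃! r : R, (∃ q : R, x = q * f + r) ∧
      (D.coeff r).support.max < (D.coeff f).support.max then h.choose else 0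

/-- The multiplication of the Petit algebra `S_f`: `g ∘ h = g·h mod_r f`. -/
noncomputable def pmul (D : DiffPolyRing K δ R) (f x y : R) : R := D.modr f (x * y)

/-- The left nucleus of the Petit algebra `S_f`, as a subset of `R`. -/
def nucl (D : DiffPolyRing K δ R) (f : R) (m : ℕ) : Set R :=
  {x ∈ D.SfSet m | ∀ y ∈ D.SfSet m, ∀ z ∈ D.SfSet m,
    D.pmul f (D.pmul f x y) z = D.pmul f x (D.pmul f y z)}

/-- The middle nucleus of the Petit algebra `S_f`, as a subset of `R`. -/
def nucm (D : DiffPolyRing K δ R) (f : R) (m : ℕ) : Set R :=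
  {x ∈ D.SfSet m | ∀ y ∈ D.SfSet m, ∀ z ∈ D.SfSet m,
    D.pmul f (D.pmul f y x) z = D.pmul f y (D.pmul f x z)}

/-- The right nucleus of the Petit algebra `S_f`, as a subset of `R`. -/
def nucr (D : DiffPolyRing K δ R) (f : R) (m : ℕ) : Set R :=
  {x ∈ D.SfSet m | ∀ y ∈ D.SfSet m, ∀ z ∈ D.SfSet m,
    D.pmul f (D.pmul f y z) x = D.pmul f y (D.pmul f z x)}

/-- The nucleus of the Petit algebra `S_f`, as a subset of `R`. -/
def nuc (D : DiffPolyRing K δ R) (f : R) (m : ℕ) : Set R :=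
  D.nucl f m ∩ D.nucm f m ∩ D.nucr f m

/-- `f` is irreducible in `K[t;δ]`: it is not a unit and admits no factorization
into two factors of strictly smaller degree. -/
def Irred (D : DiffPolyRing K δ R) (f : R) : Prop :=
  ¬IsUnit f ∧ ¬∃ g h : R, f = g * h ∧ D.deg g < D.deg f ∧ D.deg h < D.deg f

/-- The Petit algebra `S_f` is a division algebra: it is nonzero, and all left and
right multiplications by nonzero elements are bijective. -/
def IsDivisionPetit (D : DiffPolyRing K δ R) (f : R) (m : ℕ) : Prop :=
  (∃ x ∈ D.SfSet m, x ≠ 0) ∧ ∀ a ∈ D.SfSet m, a ≠ 0 →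
    Set.BijOn (fun x => D.pmul f a x) (D.SfSet m) (D.SfSet m) ∧
    Set.BijOn (fun x => D.pmul f x a) (D.SfSet m) (D.SfSet m)

/-- The unital `F`-algebra `B` realizes the right nucleus of the Petit algebra `S_f`:
there is a bijection `B ≃ Nuc_r(S_f)` preserving addition, multiplication and the
`F`-algebra structure. -/
def RightNucPresents (F : Type) [Field F] [Algebra F K] (D : DiffPolyRing K δ R)
    (f : R) (m : ℕ) (B : Type) [Ring B] [Algebra F B] : Prop :=
  ∃ φ : B ≃ (D.nucr f m),
    (∀ x y : B, ((φ (x + y) : R)) = (φ x : R) + (φ y : R)) ∧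
    (∀ x y : B, ((φ (x * y) : R)) = D.pmul f (φ x : R) (φ y : R)) ∧
    (∀ c : F, ((φ (algebraMap F B c) : R)) = D.i (algebraMap F K c))

/-- A subset `S` of an `F`-vector space has dimension `d`: it contains `d` linearly
independent vectors whose span contains `S`. -/
def SetDim (F : Type) [Field F] {M : Type} [AddCommGroup M] [Module F M]
    (S : Set M) (d : ℕ) : Prop :=
  ∃ s : Finset M, ↑s ⊆ S ∧ s.card = d ∧
    LinearIndependent F (fun x : (s : Set M) => (x : M)) ∧
    S ⊆ (Submodule.span F (s : Set M) : Set M)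

/-- `f ∈ K[t;δ]` of degree `m` is an `A`-polynomial (over the field of constants `F`),
via Amitsur's characterization: the right nucleus of `S_f` has dimension `m²` over `F`. -/
def IsAPoly (F : Type) [Field F] [Algebra F K] (D : DiffPolyRing K δ R)
    (f : R) (m : ℕ) : Prop :=
  SetDim F {x : D.Rlt m | (x : R) ∈ D.nucr f m} (m ^ 2)

/-- `f ∈ R = K[t;δ]` is bounded: there is `f* ≠ 0` such that `Rf* = f*R` is the
largest two-sided ideal of `R` contained in `Rf`. -/
def IsBounded (D : DiffPolyRing K δ R) (f : R) : Prop :=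
  ∃ fs : R, fs ≠ 0 ∧
    {x : R | ∃ r, x = r * fs} = {x : R | ∃ r, x = fs * r} ∧
    (∀ x : R, (∃ r, x = r * fs) → ∃ r, x = r * f) ∧
    ∀ J : Set R, (0 : R) ∈ J → (∀ a ∈ J, ∀ b ∈ J, a + b ∈ J) →
      (∀ r : R, ∀ a ∈ J, r * a ∈ J ∧ a * r ∈ J) →
      (∀ x ∈ J, ∃ r, x = r * f) → ∀ x ∈ J, ∃ r, x = r * fs

/-- `S_f` is a free right module of rank `n` over its right nucleus. -/
def FreeRankOverNucr (D : DiffPolyRing K δ R) (f : R) (m n : ℕ) : Prop :=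
  ∃ b : Fin n → R, (∀ j, b j ∈ D.SfSet m) ∧
    ∀ x ∈ D.SfSet m, ∃! c : Fin n → (D.nucr f m),
      x = ∑ j, D.pmul f (b j) ((c j : R))

/-- The Petit algebra `S_f` is unital with unit `1 ∈ K[t;δ]`. -/
def PetitUnital (D : DiffPolyRing K δ R) (f : R) (m : ℕ) : Prop :=
  (1 : R) ∈ D.SfSet m ∧ ∀ x ∈ D.SfSet m, D.pmul f 1 x = x ∧ D.pmul f x 1 = x

end DiffPolyRing

section CentralSimple

variable {F B C X : Type*} [Field F] [Ring B] [Algebra F B] [Field C] [Algebra F C]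
  [Ring X] [Nontrivial X]

/-- Commuting images of a field extension `C` and of a central simple `F`-algebra `B` are
linearly disjoint over `F`. -/
theorem eq_zero_of_sum_map_mul_map_eq_zero [Algebra.IsCentral F B] [IsSimpleRing B]
    (α : C →+* X) (β : B →+* X)
    (hF : ∀ r : F, β (algebraMap F B r) = α (algebraMap F C r))
    (hcomm : ∀ c b, α c * β b = β b * α c) {ι : Type*} {c : ι → C}
    (hc : LinearIndependent F c) (s : Finset ι) (b : ι → B)
    (h : ∑ i ∈ s, α (c i) * β (b i) = 0) : ∀ i ∈ s, b i = 0 := by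
  classical
  induction s using Finset.induction_on generalizing b with
  | empty => simp
  | insert k s hk ih =>
    suffices hbk : b k = 0 by
      rw [Finset.sum_insert hk, hbk, map_zero, mul_zero, zero_add] at h
      intro i hi
      rcases Finset.mem_insert.1 hi with rfl | hi
      · exact hbk
      · exact ih b h i hi
    by_contra hbk
    let J : TwoSidedIdeal B := TwoSidedIdeal.mk'
      {x | ∃ y : ι → B, α (c k) * β x + ∑ i ∈ s, α (c i) * β (y i) = 0}
      ⟨0, by simp⟩
      (by
        rintro x x' ⟨y, hy⟩ ⟨y', hy'⟩
        refine ⟨y + y', ?_⟩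
        have := congrArg₂ (· + ·) hy hy'
        simp only [Pi.add_apply, map_add, mul_add, Finset.sum_add_distrib] at this ⊢
        rw [← add_zero (0 : X), ← this]
        abel)
      (by
        rintro x ⟨y, hy⟩
        refine ⟨-y, ?_⟩
        simp only [Pi.neg_apply, map_neg, mul_neg, Finset.sum_neg_distrib]
        rw [← neg_add, hy, neg_zero])
      (by
        rintro z x ⟨y, hy⟩
        refine ⟨fun i => z * y i, ?_⟩
        have := congrArg (β z * ·) hy
        simp only [mul_add, mul_zero, Finset.mul_sum, ← mul_assoc, ← hcomm] at this
        simpa only [map_mul, ← mul_assoc] using this)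
      (by
        rintro x z ⟨y, hy⟩
        refine ⟨fun i => y i * z, ?_⟩
        have := congrArg (· * β z) hy
        simp only [add_mul, zero_mul, Finset.sum_mul] at this
        simpa only [map_mul, ← mul_assoc] using this)
    have hkJ : b k ∈ J := by
      rw [TwoSidedIdeal.mem_mk']
      exact ⟨b, by rwa [Finset.sum_insert hk] at h⟩
    have h1 := IsSimpleRing.one_mem_of_ne_zero_mem J hbk hkJ
    rw [TwoSidedIdeal.mem_mk'] at h1
    obtain ⟨y, hy⟩ := h1
    rw [map_one, mul_one] at hy
    have hcen : ∀ i ∈ s, ∃ r : F, y i = algebraMap F B r := by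
      intro i hi
      rw [← Algebra.IsCentral.mem_center_iff F, Subalgebra.mem_center_iff]
      intro z
      have h2 : ∑ i ∈ s, α (c i) * β (z * y i - y i * z) = 0 := by
        have e : ∀ i, α (c i) * β (z * y i - y i * z) =
            β z * (α (c i) * β (y i)) - α (c i) * β (y i) * β z := fun i => by
          rw [map_sub, map_mul, map_mul, mul_sub, ← mul_assoc, ← mul_assoc, hcomm, mul_assoc]
        rw [Finset.sum_congr rfl fun i _ => e i, Finset.sum_sub_distrib, ← Finset.mul_sum,
          ← Finset.sum_mul, eq_neg_of_add_eq_zero_right hy, mul_neg, neg_mul, hcomm, sub_self]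
      exact sub_eq_zero.1 (ih _ h2 i hi)
    choose! r hr using hcen
    have h3 : α (c k + ∑ i ∈ s, r i • c i) = 0 := by
      rw [← hy, map_add, map_sum]
      congr 1
      refine Finset.sum_congr rfl fun i hi => ?_
      rw [hr i hi, hF, Algebra.smul_def, map_mul, ← map_mul, ← map_mul, mul_comm]
    rw [map_eq_zero_iff α α.injective] at h3
    have h4 := linearIndependent_iff'.1 hc (insert k s) (fun i => if i = k then 1 else r i) (by
      rw [Finset.sum_insert hk, if_pos rfl, one_smul, ← h3]
      congr 1
      refine Finset.sum_congr rfl fun i hi => ?_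
      rw [if_neg (ne_of_mem_of_not_mem hi hk)]) k (Finset.mem_insert_self k s)
    simp at h4

/-- Every algebra homomorphism from a scalar extension of a central simple algebra to a
nontrivial algebra is injective. -/
theorem injective_of_tensorProduct_centralSimple [Algebra.IsCentral F B] [IsSimpleRing B]
    [Algebra C X] (ρ : C ⊗[F] B →ₐ[C] X) : Function.Injective ρ := by
  rw [injective_iff_map_eq_zero]
  classical
  intro z hz
  let 𝓒 := Module.Basis.ofVectorSpace F C
  obtain ⟨y, rfl⟩ := (TensorProduct.equivFinsuppOfBasisLeft (N := B) 𝓒).symm.surjective z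
  suffices hy : y = 0 by rw [hy, map_zero]
  have key := eq_zero_of_sum_map_mul_map_eq_zero (algebraMap C X)
    ((ρ : C ⊗[F] B →+* X).comp
      (Algebra.TensorProduct.includeRight : B →ₐ[F] C ⊗[F] B).toRingHom)
    (fun r => by
      have : (1 : C) ⊗ₜ[F] algebraMap F B r = algebraMap C (C ⊗[F] B) (algebraMap F C r) := by
        rw [Algebra.TensorProduct.algebraMap_apply, Algebra.algebraMap_eq_smul_one,
          ← TensorProduct.smul_tmul, ← Algebra.algebraMap_eq_smul_one]
        rfl
      exact (congrArg ρ this).trans (ρ.commutes _))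
    (fun c b => Algebra.commutes _ _) 𝓒.linearIndependent y.support y (by
      rw [← hz, TensorProduct.equivFinsuppOfBasisLeft_symm_apply, Finsupp.sum, map_sum]
      refine Finset.sum_congr rfl fun i _ => ?_
      have : 𝓒 i ⊗ₜ[F] y i = algebraMap C (C ⊗[F] B) (𝓒 i) * ((1 : C) ⊗ₜ[F] y i) := by
        simp [Algebra.TensorProduct.algebraMap_apply]
      rw [this, map_mul, AlgHom.commutes]
      rfl)
  ext i
  by_cases hi : i ∈ y.support
  · exact key i hi
  · simpa using hi

theorem bijective_of_tensorProduct_centralSimple [Algebra.IsCentral F B] [IsSimpleRing B]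
    [Algebra C X] [Module.Finite C X] (ρ : C ⊗[F] B →ₐ[C] X)
    (hX : Module.finrank C X ≤ Module.finrank F B) : Function.Bijective ρ := by
  have hinj := injective_of_tensorProduct_centralSimple ρ
  have : Module.Finite C (C ⊗[F] B) := Module.Finite.of_injective ρ.toLinearMap hinj
  have hle := LinearMap.finrank_le_finrank_of_injective (f := ρ.toLinearMap) hinj
  rw [Module.finrank_baseChange] at hle
  exact ⟨hinj, (LinearMap.injective_iff_surjective_of_finrank_eq_finrank (f := ρ.toLinearMap)
    (by rw [Module.finrank_baseChange]; exact le_antisymm hle hX)).1 hinj⟩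

/-- A homomorphism of `F`-algebras into a `C`-algebra extends to the scalar extension. -/
theorem nonempty_algHom_tensorProduct {X : Type*} [Ring X] [Algebra C X] (β : B →+* X)
    (hβ : ∀ r : F, β (algebraMap F B r) = algebraMap C X (algebraMap F C r)) :
    Nonempty (C ⊗[F] B →ₐ[C] X) := by
  let _ : Algebra F X := Algebra.compHom X (algebraMap F C)
  have : IsScalarTower F C X := IsScalarTower.of_algebraMap_eq fun _ => rfl
  exact ⟨Algebra.TensorProduct.lift (Algebra.ofId C X) { β with commutes' := hβ }
    fun c b => Algebra.commutes _ _⟩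

end CentralSimple

namespace DiffPolyRing

section Coefficients

variable {L : Type} [Field L] {δ : Der L} {R : Type} [Ring R] (D : DiffPolyRing L δ R)

theorem coeff_eq_iff {x : R} {c : ℕ →₀ L} :
    D.coeff x = c ↔ x = c.sum fun n a => D.i a * D.t ^ n :=
  ⟨fun h => h ▸ D.repr' x, fun h => (D.coeff_unique x c h).symm⟩

theorem coeff_injective : Function.Injective D.coeff := fun x y h => by
  rw [D.repr' x, h, ← D.repr' y]

theorem coeff_monomial (n : ℕ) (a : L) :
    D.coeff (D.i a * D.t ^ n) = Finsupp.single n a := by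
  rw [coeff_eq_iff, Finsupp.sum_single_index (by simp)]

theorem coeff_i (a : L) : D.coeff (D.i a) = Finsupp.single 0 a := by
  simpa using D.coeff_monomial 0 a

theorem coeff_sub (x y : R) : D.coeff (x - y) = D.coeff x - D.coeff y := by
  rw [sub_eq_add_neg, coeff_add, coeff_neg, sub_eq_add_neg]

theorem coeff_sum {ι : Type*} (s : Finset ι) (x : ι → R) :
    D.coeff (∑ i ∈ s, x i) = ∑ i ∈ s, D.coeff (x i) :=
  map_sum (AddMonoidHom.mk' D.coeff D.coeff_add) x s

theorem deg_lt_iff {x : R} {n : ℕ} : D.deg x < n ↔ ∀ k, n ≤ k → D.coeff x k = 0 := by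
  rw [deg, Finset.max_eq_sup_withBot, Nat.cast_withBot,
    Finset.sup_lt_iff (WithBot.bot_lt_coe n)]
  simp only [Finsupp.mem_support_iff, WithBot.coe_lt_coe]
  exact forall_congr' fun k => by rw [not_imp_comm, not_lt]

theorem deg_le_iff {x : R} {n : ℕ} : D.deg x ≤ n ↔ ∀ k, n < k → D.coeff x k = 0 := by
  rw [deg, Finset.max_le_iff]
  simp only [Finsupp.mem_support_iff, Nat.cast_withBot, WithBot.coe_le_coe]
  exact forall_congr' fun k => by rw [not_imp_comm, not_le]

theorem coeff_ne_zero_of_deg_eq {x : R} {n : ℕ} (h : D.deg x = n) : D.coeff x n ≠ 0 :=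
  Finsupp.mem_support_iff.1 (Finset.mem_of_max h)

theorem deg_eq_of {x : R} {n : ℕ} (h : D.deg x ≤ n) (hn : D.coeff x n ≠ 0) : D.deg x = n :=
  le_antisymm h (Finset.le_max (Finsupp.mem_support_iff.2 hn))

theorem ne_zero_of_deg_eq {x : R} {n : ℕ} (h : D.deg x = n) : x ≠ 0 := by
  rintro rfl
  exact D.coeff_ne_zero_of_deg_eq h (by rw [coeff_zero, Finsupp.coe_zero, Pi.zero_apply])

theorem coeff_linear_sub (a : L) :
    D.coeff (D.t - D.i a) = Finsupp.single 1 1 - Finsupp.single 0 a := by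
  rw [coeff_sub, coeff_i, ← D.coeff_monomial 1 1, map_one, one_mul, pow_one]

theorem deg_linear (a : L) : D.deg (D.t - D.i a) = (1 : ℕ) := by
  refine D.deg_eq_of (D.deg_le_iff.2 fun k hk => ?_) ?_
  · rw [coeff_linear_sub, Finsupp.sub_apply, Finsupp.single_eq_of_ne (by omega),
      Finsupp.single_eq_of_ne (by omega), sub_zero]
  · simp [coeff_linear_sub]

theorem coeff_t_mul_succ (x : R) (n : ℕ) :
    D.coeff (D.t * x) (n + 1) = D.coeff x n + δ.toFun (D.coeff x (n + 1)) := by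
  have h0 : δ.toFun 0 = 0 := by simpa using δ.map_add' 0 0
  have key : ∀ c : ℕ →₀ L, D.coeff (D.t * c.sum fun n a => D.i a * D.t ^ n) (n + 1) =
      c n + δ.toFun (c (n + 1)) := fun c => by
    classical
    induction c using Finsupp.induction_linear with
    | zero => simp [coeff_zero, h0]
    | add c d hc hd =>
      rw [Finsupp.sum_add_index' (by simp) (by intro n a b; rw [map_add, add_mul]), mul_add,
        coeff_add, Finsupp.add_apply, hc, hd, Finsupp.add_apply, Finsupp.add_apply, δ.map_add']
      ring
    | single k a =>
      rw [Finsupp.sum_single_index (by simp), ← mul_assoc, D.t_mul, add_mul, mul_assoc,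
        ← pow_succ', coeff_add, coeff_monomial, coeff_monomial]
      simp only [Finsupp.add_apply, Finsupp.single_apply, add_left_inj]
      split_ifs <;> simp [h0]
  conv_lhs => rw [D.repr' x]
  exact key _

theorem deg_linear_mul (a : L) {x : R} {n : ℕ} (hx : D.deg x = n) :
    D.deg ((D.t - D.i a) * x) = (n + 1 : ℕ) := by
  have h0 : δ.toFun 0 = 0 := by simpa using δ.map_add' 0 0
  have hx' := D.deg_le_iff.1 hx.le
  have key : ∀ k, D.coeff ((D.t - D.i a) * x) (k + 1) =
      D.coeff x k + δ.toFun (D.coeff x (k + 1)) - a * D.coeff x (k + 1) := fun k => by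
    rw [sub_mul, coeff_sub, coeff_smul, Finsupp.sub_apply, coeff_t_mul_succ]
    rfl
  refine D.deg_eq_of (D.deg_le_iff.2 fun k hk => ?_) ?_
  · obtain ⟨k, rfl⟩ := Nat.exists_eq_add_one_of_ne_zero (by omega : k ≠ 0)
    rw [key, hx' k (by omega), hx' (k + 1) (by omega), h0]
    ring
  · rw [key, hx' (n + 1) (by omega), h0]
    simpa using D.coeff_ne_zero_of_deg_eq hx

theorem eq_zero_of_deg_mul_lt {f q : R} (hf : f ≠ 0) (h : D.deg (q * f) < D.deg f) :
    q * f = 0 :=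
  (D.rightDiv f (q * f) hf).unique ⟨⟨0, by simp⟩, h⟩
    ⟨⟨q, by simp⟩, by
      change D.deg 0 < D.deg f
      rw [D.deg_zero]
      exact bot_lt_of_lt h⟩

theorem exists_eq_mul_add {f : R} (hf : f ≠ 0) (x : R) :
    ∃ q r, x = q * f + r ∧ D.deg r < D.deg f :=
  let ⟨r, ⟨⟨q, hq⟩, hr⟩, _⟩ := D.rightDiv f x hf
  ⟨q, r, hq, hr⟩

theorem modr_spec {f : R} (hf : f ≠ 0) (x : R) :
    (∃ q, x = q * f + D.modr f x) ∧ D.deg (D.modr f x) < D.deg f := by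
  have h := D.rightDiv f x hf
  rw [modr, dif_pos h]
  exact h.choose_spec.1

theorem modr_eq_iff {f : R} (hf : f ≠ 0) (x y : R) :
    D.modr f x = D.modr f y ↔ ∃ q, x - y = q * f := by
  obtain ⟨⟨q, hq⟩, hr⟩ := D.modr_spec hf x
  obtain ⟨⟨q', hq'⟩, hr'⟩ := D.modr_spec hf y
  constructor
  · intro h
    refine ⟨q - q', ?_⟩
    rw [sub_mul, eq_sub_of_add_eq hq.symm, eq_sub_of_add_eq hq'.symm, h]
    abel
  · rintro ⟨p, hp⟩
    refine (D.rightDiv f x hf).unique ⟨⟨q, hq⟩, hr⟩ ⟨⟨p + q', ?_⟩, hr'⟩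
    rw [add_mul, ← hp, add_assoc, ← hq', sub_add_cancel]

/-- The right nucleus of `S_f` is the eigenring of `f`. -/
theorem mem_nucr_iff {f : R} {m : ℕ} (hm : 2 ≤ m) (hf : D.deg f = m) {x : R} :
    x ∈ D.nucr f m ↔ D.deg x < m ∧ ∃ q, f * x = q * f := by
  have hf0 := D.ne_zero_of_deg_eq hf
  refine and_congr_right fun _ => ⟨fun h => ?_, ?_⟩
  · have h1 : D.t ∈ D.SfSet m := D.deg_lt_iff.2 fun k hk => by
      have := D.coeff_monomial 1 1
      rw [map_one, one_mul, pow_one] at this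
      rw [this, Finsupp.single_eq_of_ne (by omega)]
    have h2 : D.t ^ (m - 1) ∈ D.SfSet m := D.deg_lt_iff.2 fun k hk => by
      have := D.coeff_monomial (m - 1) 1
      rw [map_one, one_mul] at this
      rw [this, Finsupp.single_eq_of_ne (by omega)]
    have h3 := h _ h1 _ h2
    simp only [pmul] at h3
    rw [modr_eq_iff _ hf0, ← pow_succ', Nat.sub_add_cancel (by omega)] at h3
    obtain ⟨p, hp⟩ := h3
    obtain ⟨⟨q, hq⟩, -⟩ := D.modr_spec hf0 (D.t ^ (m - 1) * x)
    set u := D.coeff f m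
    have hu : u ≠ 0 := D.coeff_ne_zero_of_deg_eq hf
    have hmod : D.modr f (D.t ^ m) = D.t ^ m - D.i u⁻¹ * f := by
      refine (D.rightDiv f (D.t ^ m) hf0).unique (D.modr_spec hf0 _)
        ⟨⟨D.i u⁻¹, by simp⟩, ?_⟩
      change D.deg _ < D.deg f
      rw [hf, deg_lt_iff]
      intro k hk
      have := D.coeff_monomial m 1
      rw [map_one, one_mul] at this
      rw [coeff_sub, this, coeff_smul]
      rcases hk.eq_or_lt with rfl | hk
      · simp [u, hu]
      · rw [Finsupp.sub_apply, Finsupp.single_eq_of_ne (by omega), Finsupp.smul_apply,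
          D.deg_le_iff.1 hf.le k hk]
        simp
    have h4 : D.i u⁻¹ * (f * x) = (D.t * q - p) * f := by
      have h5 : D.t * (D.t ^ (m - 1) * x) = D.t ^ m * x := by
        rw [← mul_assoc, ← pow_succ', Nat.sub_add_cancel (by omega)]
      rw [sub_mul, ← hp, hmod, sub_mul, mul_assoc, mul_assoc, eq_sub_of_add_eq hq.symm, mul_sub, h5]
      abel
    refine ⟨D.i u * (D.t * q - p), ?_⟩
    rw [mul_assoc, ← h4, ← mul_assoc, ← map_mul, mul_inv_cancel₀ hu, map_one, one_mul]
  · rintro ⟨p, hp⟩ y - z -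
    simp only [pmul]
    rw [modr_eq_iff _ hf0]
    obtain ⟨⟨q, hq⟩, -⟩ := D.modr_spec hf0 (y * z)
    obtain ⟨⟨q', hq'⟩, -⟩ := D.modr_spec hf0 (z * x)
    refine ⟨y * q' - q * p, ?_⟩
    rw [eq_sub_of_add_eq' hq.symm, eq_sub_of_add_eq' hq'.symm, sub_mul, mul_sub, sub_mul,
      mul_assoc q, mul_assoc q, hp]
    noncomm_ring

end Coefficients

section CyclicModule

variable {L : Type} [Field L] {δ : Der L} {R : Type} [Ring R]

/-- The cyclic left module `R/Rf` over `R = L[t;δ]`. -/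
def Cyc (_ : DiffPolyRing L δ R) (f : R) : Type := R ⧸ (Submodule.span R {f} : Submodule R R)

variable (D : DiffPolyRing L δ R) (f g : R) (C : Type) [Field C] [Algebra C L]

instance : AddCommGroup (D.Cyc f) :=
  inferInstanceAs (AddCommGroup (R ⧸ (Submodule.span R {f} : Submodule R R)))

instance : Module R (D.Cyc f) :=
  inferInstanceAs (Module R (R ⧸ (Submodule.span R {f} : Submodule R R)))

instance : Module C (D.Cyc f) := Module.compHom _ (D.i.comp (algebraMap C L))

/-- The canonical generator of `R/Rf`. -/
def Cyc.gen : D.Cyc f := Submodule.Quotient.mk (p := Submodule.span R {f}) 1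

variable {C}

theorem Cyc.field_smul_def (c : C) (v : D.Cyc f) : c • v = D.i (algebraMap C L c) • v := rfl

theorem Cyc.smul_def (a : L) (v : D.Cyc f) : a • v = D.i a • v := rfl

instance : IsScalarTower C L (D.Cyc f) :=
  ⟨fun c a v => by
    rw [Cyc.smul_def, Cyc.field_smul_def, Cyc.smul_def, Algebra.smul_def, map_mul, mul_smul]⟩

instance : LinearMap.CompatibleSMul (D.Cyc g) (D.Cyc f) L R :=
  ⟨fun φ a v => by rw [Cyc.smul_def, Cyc.smul_def, map_smul]⟩

theorem Cyc.smulCommClass (hC : δ.HasConstants C) : SMulCommClass R C (D.Cyc f) := by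
  have ht : ∀ c : C, D.t * D.i (algebraMap C L c) = D.i (algebraMap C L c) * D.t := fun c => by
    rw [D.t_mul, (hC _).2 ⟨c, rfl⟩, map_zero, add_zero]
  refine ⟨fun x c v => ?_⟩
  rw [Cyc.field_smul_def, Cyc.field_smul_def, smul_smul, smul_smul]
  congr 1
  rw [D.repr' x, Finsupp.sum, Finset.sum_mul, Finset.mul_sum]
  refine Finset.sum_congr rfl fun n _ => ?_
  rw [← mul_assoc, ← map_mul, mul_comm (algebraMap C L c), map_mul, mul_assoc, mul_assoc,
    ((show Commute _ _ from ht c).pow_left n).eq]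

variable {f} in
theorem Cyc.smul_gen_eq_zero_iff {x : R} : x • Cyc.gen D f = 0 ↔ ∃ q, x = q * f := by
  have : x • Cyc.gen D f = Submodule.Quotient.mk (p := Submodule.span R {f}) (x • 1) := rfl
  rw [this]
  erw [Submodule.Quotient.mk_eq_zero]
  rw [smul_eq_mul, mul_one, Submodule.mem_span_singleton]
  exact exists_congr fun q => by rw [smul_eq_mul, eq_comm]

theorem Cyc.smul_gen_self : f • Cyc.gen D f = 0 :=
  (Cyc.smul_gen_eq_zero_iff D).2 ⟨1, (one_mul f).symm⟩

variable {f} in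
theorem Cyc.exists_smul_gen (v : D.Cyc f) : ∃ x : R, v = x • Cyc.gen D f := by
  obtain ⟨x, rfl⟩ := Submodule.Quotient.mk_surjective (Submodule.span R {f}) v
  refine ⟨x, ?_⟩
  change _ = Submodule.Quotient.mk (p := Submodule.span R {f}) (x • 1)
  rw [smul_eq_mul, mul_one]

variable {f} in
/-- The homomorphism from `R/Rf` sending the generator to an element killed by `f`. -/
def Cyc.lift {g : R} (v : D.Cyc g) (hv : f • v = 0) : D.Cyc f →ₗ[R] D.Cyc g :=
  Submodule.liftQ (Submodule.span R {f}) (LinearMap.toSpanSingleton R _ v) (by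
    rw [Submodule.span_singleton_le_iff_mem]
    simpa using hv)

variable {f} in
@[simp]
theorem Cyc.lift_gen {g : R} (v : D.Cyc g) (hv : f • v = 0) :
    Cyc.lift D v hv (Cyc.gen D f) = v := by
  change (1 : R) • v = v
  exact one_smul R v

variable {f g} in
theorem Cyc.hom_ext {φ ψ : D.Cyc f →ₗ[R] D.Cyc g}
    (h : φ (Cyc.gen D f) = ψ (Cyc.gen D f)) : φ = ψ := by
  ext v
  obtain ⟨x, rfl⟩ := Cyc.exists_smul_gen D v
  rw [map_smul, map_smul, h]

variable {f} in
theorem Cyc.exists_basis {m : ℕ} (hf : D.deg f = m) :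
    Nonempty (Module.Basis (Fin m) L (D.Cyc f)) := by
  have hf0 := D.ne_zero_of_deg_eq hf
  have hsum : ∀ c : Fin m → L, ∑ k, c k • (D.t ^ (k : ℕ) • Cyc.gen D f) =
      (∑ k, D.i (c k) * D.t ^ (k : ℕ)) • Cyc.gen D f := fun c => by
    rw [Finset.sum_smul]
    exact Finset.sum_congr rfl fun k _ => by rw [Cyc.smul_def, smul_smul]
  have hcoeff : ∀ (c : Fin m → L) (n : ℕ),
      D.coeff (∑ k, D.i (c k) * D.t ^ (k : ℕ)) n = if h : n < m then c ⟨n, h⟩ else 0 :=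
    fun c n => by
      rw [coeff_sum, Finsupp.finsetSum_apply]
      simp only [coeff_monomial, Finsupp.single_apply]
      split_ifs with h
      · rw [Finset.sum_eq_single ⟨n, h⟩ (fun k _ hk => if_neg fun e => hk (Fin.ext e))
          (by simp), if_pos rfl]
      · exact Finset.sum_eq_zero fun k _ => if_neg fun e : (k : ℕ) = n => h (e ▸ k.2)
  have hli : LinearIndependent L fun k : Fin m => D.t ^ (k : ℕ) • Cyc.gen D f := by
    rw [Fintype.linearIndependent_iff]
    intro c hc k
    rw [hsum, Cyc.smul_gen_eq_zero_iff] at hc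
    obtain ⟨q, hq⟩ := hc
    have h0 : D.deg (q * f) < D.deg f := by
      rw [← hq, hf, deg_lt_iff]
      intro n hn
      rw [hcoeff, dif_neg (by omega)]
    have h1 := hcoeff c k
    rw [hq, D.eq_zero_of_deg_mul_lt hf0 h0, coeff_zero, dif_pos k.2] at h1
    exact h1.symm
  refine ⟨Module.Basis.mk hli fun v _ => ?_⟩
  obtain ⟨x, rfl⟩ := Cyc.exists_smul_gen D v
  obtain ⟨q, r, rfl, hr⟩ := D.exists_eq_mul_add hf0 x
  have hr' : r = ∑ k : Fin m, D.i (D.coeff r k) * D.t ^ (k : ℕ) := by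
    refine D.coeff_injective (Finsupp.ext fun n => ?_)
    rw [hcoeff]
    split_ifs with h
    · rfl
    · exact D.deg_lt_iff.1 (hf ▸ hr) n (by omega)
  rw [add_smul, mul_smul, Cyc.smul_gen_self, smul_zero, zero_add, hr', ← hsum]
  exact Submodule.sum_mem _ fun k _ =>
    Submodule.smul_mem _ _ (Submodule.subset_span ⟨k, rfl⟩)

variable {f} in
theorem Cyc.finite {m : ℕ} (hf : D.deg f = m) : Module.Finite L (D.Cyc f) :=
  let ⟨b⟩ := Cyc.exists_basis D hf
  Module.Finite.of_basis b

variable {f} in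
theorem Cyc.finrank {m : ℕ} (hf : D.deg f = m) : Module.finrank L (D.Cyc f) = m := by
  obtain ⟨b⟩ := Cyc.exists_basis D hf
  rw [Module.finrank_eq_card_basis b, Fintype.card_fin]

variable [SMulCommClass R C (D.Cyc f)]

instance : Algebra C (Module.End R (D.Cyc f)) :=
  Algebra.ofModule (fun _ _ _ => rfl) fun c φ ψ => LinearMap.ext fun v =>
    ((φ.restrictScalars L).map_smul_of_tower c (ψ v))

variable {f g} in
/-- Homomorphisms of differential modules that are independent over the constants are
independent over the differential field. -/
theorem Cyc.linearIndependent_hom (hC : δ.HasConstants C) {ι : Type*}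
    {φ : ι → (D.Cyc g →ₗ[R] D.Cyc f)} (hφ : LinearIndependent C φ) :
    LinearIndependent L fun i => (φ i).restrictScalars L := by
  classical
  rw [linearIndependent_iff']
  intro s
  induction s using Finset.induction_on with
  | empty => simp
  | insert k s hk ih =>
    intro a ha
    suffices hak : a k = 0 by
      rw [Finset.sum_insert hk, hak, zero_smul, zero_add] at ha
      intro i hi
      rcases Finset.mem_insert.1 hi with rfl | hi
      · exact hak
      · exact ih a ha i hi
    by_contra hak
    set b : ι → L := fun i => (a k)⁻¹ * a i
    have hb : ∀ v, φ k v + ∑ i ∈ s, b i • φ i v = 0 := fun v => by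
      have := congrArg (fun χ => (a k)⁻¹ • χ v) ha
      simpa [Finset.sum_insert hk, Finset.smul_sum, smul_smul, hak, b] using this
    have hδ : ∀ i ∈ s, δ.toFun (b i) = 0 := by
      refine ih (fun i => δ.toFun (b i)) (LinearMap.ext fun v => ?_)
      have h1 := congrArg (D.t • ·) (hb v)
      have h2 := hb (D.t • v)
      have h3 : ∀ i, D.t • b i • φ i v = b i • D.t • φ i v + δ.toFun (b i) • φ i v := fun i => by
        simp only [Cyc.smul_def, smul_smul, D.t_mul, add_smul]
      simp only [smul_add, Finset.smul_sum, h3, Finset.sum_add_distrib, smul_zero] at h1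
      simp only [map_smul] at h2
      rw [← add_assoc, h2, zero_add] at h1
      simpa using h1
    choose! c hc using fun i hi => (hC _).1 (hδ i hi)
    have h4 := linearIndependent_iff'.1 hφ (insert k s) (fun i => if i = k then 1 else c i) (by
      rw [Finset.sum_insert hk, if_pos rfl, one_smul]
      ext v
      rw [LinearMap.add_apply, LinearMap.sum_apply, LinearMap.zero_apply, ← hb v]
      congr 1
      refine Finset.sum_congr rfl fun i hi => ?_
      rw [if_neg (ne_of_mem_of_not_mem hi hk), LinearMap.smul_apply, Cyc.field_smul_def,
        hc i hi, Cyc.smul_def]) k (Finset.mem_insert_self k s)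
    simp at h4

variable {f g} in
theorem Cyc.finite_hom_and_finrank_le (hC : δ.HasConstants C) {m n : ℕ} (hf : D.deg f = m)
    (hg : D.deg g = n) : Module.Finite C (D.Cyc g →ₗ[R] D.Cyc f) ∧
      Module.finrank C (D.Cyc g →ₗ[R] D.Cyc f) ≤ n * m := by
  have := Cyc.finite D hf
  have := Cyc.finite D hg
  let b := Module.Basis.ofVectorSpace C (D.Cyc g →ₗ[R] D.Cyc f)
  have hb := Cyc.linearIndependent_hom D hC b.linearIndependent
  have := hb.finite
  have := Fintype.ofFinite (Module.Basis.ofVectorSpaceIndex C (D.Cyc g →ₗ[R] D.Cyc f))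
  refine ⟨Module.Finite.of_basis b, ?_⟩
  rw [Module.finrank_eq_card_basis b, ← Cyc.finrank D hf, ← Cyc.finrank D hg,
    ← Module.finrank_linearMap L L]
  exact hb.fintype_card_le_finrank

end CyclicModule

section Eigenring

variable {L : Type} [Field L] {δ : Der L} {R : Type} [Ring R] (D : DiffPolyRing L δ R)
  {C : Type} [Field C] [Algebra C L] {f : R} {m : ℕ}

theorem Cyc.eq_of_smul_gen_eq (hf : D.deg f = m) {x y : R} (hx : D.deg x < m)
    (hy : D.deg y < m) (h : x • Cyc.gen D f = y • Cyc.gen D f) : x = y := by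
  rw [← sub_eq_zero, ← sub_smul, Cyc.smul_gen_eq_zero_iff] at h
  obtain ⟨q, hq⟩ := h
  rw [← sub_eq_zero, hq]
  refine D.eq_zero_of_deg_mul_lt (D.ne_zero_of_deg_eq hf) ?_
  rw [← hq, hf, sub_eq_add_neg]
  exact D.deg_add_lt hx (by rwa [D.deg_neg])

theorem Cyc.modr_smul_gen (hf : f ≠ 0) (x : R) :
    D.modr f x • Cyc.gen D f = x • Cyc.gen D f := by
  obtain ⟨⟨q, hq⟩, -⟩ := D.modr_spec hf x
  conv_rhs => rw [hq, add_smul, mul_smul, Cyc.smul_gen_self, smul_zero, zero_add]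

theorem deg_i_lt (hm : 2 ≤ m) (a : L) : D.deg (D.i a) < m := D.deg_lt_iff.2 fun k hk => by
  rw [coeff_i, Finsupp.single_eq_of_ne (by omega)]

/-- The right nucleus of `S_f` is anti-isomorphic to the endomorphism ring of `R/Rf`. -/
theorem rightNucPresents_of_algEquiv [SMulCommClass R C (D.Cyc f)] (hm : 2 ≤ m)
    (hf : D.deg f = m) {A : Type} [Ring A] [Algebra C A]
    (e : A ≃ₐ[C] (Module.End R (D.Cyc f))ᵐᵒᵖ) : D.RightNucPresents C f m A := by
  have hf0 := D.ne_zero_of_deg_eq hf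
  have hnuc : ∀ a : A, ∃ x : D.nucr f m,
      (x : R) • Cyc.gen D f = (e a).unop (Cyc.gen D f) := fun a => by
    obtain ⟨y, hy⟩ := Cyc.exists_smul_gen D ((e a).unop (Cyc.gen D f))
    refine ⟨⟨D.modr f y, (D.mem_nucr_iff hm hf).2 ⟨(D.modr_spec hf0 y).2.trans_eq hf, ?_⟩⟩, ?_⟩
    · rw [← Cyc.smul_gen_eq_zero_iff D, mul_smul, Cyc.modr_smul_gen D hf0, ← hy, ← map_smul,
        Cyc.smul_gen_self, map_zero]
    · rw [Cyc.modr_smul_gen D hf0, hy]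
  choose σ hσ using hnuc
  have hlt : ∀ a, D.deg (σ a : R) < m := fun a => (σ a).2.1
  have huniq : ∀ (a : A) (x : R), D.deg x < m →
      (e a).unop (Cyc.gen D f) = x • Cyc.gen D f → (σ a : R) = x := fun a x hx h =>
    Cyc.eq_of_smul_gen_eq D hf (hlt a) hx ((hσ a).trans h)
  refine ⟨Equiv.ofBijective σ ⟨fun a b h => ?_, fun x => ?_⟩, fun a b => ?_, fun a b => ?_,
    fun c => ?_⟩
  · refine e.injective (MulOpposite.unop_injective (Cyc.hom_ext D ?_))
    rw [← hσ, ← hσ, h]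
  · obtain ⟨hx, q, hq⟩ := (D.mem_nucr_iff hm hf).1 x.2
    refine ⟨e.symm (MulOpposite.op (Cyc.lift D ((x : R) • Cyc.gen D f) ?_)),
      Subtype.ext (huniq _ _ hx ?_)⟩
    · rw [← mul_smul, hq, mul_smul, Cyc.smul_gen_self, smul_zero]
    · rw [AlgEquiv.apply_symm_apply, MulOpposite.unop_op, Cyc.lift_gen]
  · refine huniq _ _ (D.deg_add_lt (hlt a) (hlt b)) ?_
    rw [map_add, MulOpposite.unop_add, LinearMap.add_apply, add_smul, ← hσ, ← hσ]
    rfl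
  · refine huniq _ (D.modr f (σ a * σ b)) ((D.modr_spec hf0 _).2.trans_eq hf) ?_
    rw [Cyc.modr_smul_gen D hf0, map_mul, MulOpposite.unop_mul, Module.End.mul_apply, ← hσ,
      map_smul, ← hσ, smul_smul]
  · refine huniq _ _ (D.deg_i_lt hm _) ?_
    rw [AlgEquiv.commutes]
    rfl

/-- Splitting of the endomorphism ring of `R/Rf` yields a linear right factor of `f`. -/
theorem exists_right_factor_of_algEquiv [SMulCommClass R C (D.Cyc f)] (hm : 2 ≤ m)
    (hf : D.deg f = m) (e : Matrix (Fin m) (Fin m) C ≃ₐ[C] (Module.End R (D.Cyc f))ᵐᵒᵖ) :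
    ∃ (a : L) (g : R), f = g * (D.t - D.i a) := by
  have := Cyc.finite D hf
  set u : Fin m → Fin m → Module.End R (D.Cyc f) :=
    fun k l => (e (Matrix.single l k 1)).unop with hu
  have hmul : ∀ k l p q, u k l * u p q = if l = p then u k q else 0 := fun k l p q => by
    rw [hu]
    dsimp only
    rw [← MulOpposite.unop_mul, ← map_mul]
    split_ifs with h
    · rw [h, Matrix.single_mul_single_same, mul_one]
    · rw [Matrix.single_mul_single_of_ne _ _ _ _ (Ne.symm h), map_zero, MulOpposite.unop_zero]
  let o : Fin m := ⟨0, by omega⟩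
  let V : Submodule L (D.Cyc f) := LinearMap.range ((u o o).restrictScalars L)
  have hV : ∀ w ∈ V, u o o w = w := by
    rintro _ ⟨w, rfl⟩
    have := congrArg (· w) (hmul o o o o)
    simpa using this
  let Φ : (Fin m → V) →ₗ[L] D.Cyc f :=
    LinearMap.lsum L (fun _ => V) L fun k => ((u k o).restrictScalars L).comp V.subtype
  have hΦ : ∀ (w : Fin m → V) (l : Fin m), u o l (Φ w) = w l := fun w l => by
    have : Φ w = ∑ k, u k o (w k) := by simp [Φ, LinearMap.lsum_apply]
    rw [this, map_sum]
    have h1 : ∀ k, u o l (u k o (w k)) = if l = k then (w k : D.Cyc f) else 0 := fun k => by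
      rw [← Module.End.mul_apply, hmul o l k o]
      split_ifs
      · exact hV _ (w k).2
      · rfl
    simp [h1]
  have hΦinj : Function.Injective Φ := fun w w' h => by
    ext l
    rw [← hΦ, ← hΦ, h]
  have hV1 : Module.finrank L V ≤ 1 := by
    have := LinearMap.finrank_le_finrank_of_injective hΦinj
    rw [Module.finrank_pi_fintype, Cyc.finrank D hf] at this
    simp only [Finset.sum_const, Finset.card_univ, Fintype.card_fin, smul_eq_mul] at this
    exact Nat.le_of_mul_le_mul_left (by simpa using this) (by omega : 0 < m)
  set v := u o o (Cyc.gen D f) with hv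
  have hv0 : v ≠ 0 := fun h => by
    have h1 : u o o = 0 := Cyc.hom_ext D h
    have h2 : Matrix.single o o (1 : C) = 0 :=
      e.injective (MulOpposite.unop_injective (by rw [map_zero]; exact h1))
    simpa using congrFun (congrFun h2 o) o
  obtain ⟨a, ha⟩ : ∃ a : L, a • v = D.t • v := by
    have hvV : v ∈ V := ⟨_, rfl⟩
    have htV : D.t • v ∈ V := ⟨D.t • Cyc.gen D f, (u o o).map_smul _ _⟩
    obtain ⟨a, ha⟩ := exists_smul_eq_of_finrank_eq_one (le_antisymm hV1
      (Nat.one_le_iff_ne_zero.2 fun h => hv0 (by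
        have := Submodule.finrank_eq_zero.1 h
        rwa [this, Submodule.mem_bot] at hvV)))
      (x := (⟨v, hvV⟩ : V)) (fun h => hv0 (congrArg Subtype.val h)) ⟨_, htV⟩
    exact ⟨a, congrArg Subtype.val ha⟩
  obtain ⟨q, r, hq, hr⟩ := D.exists_eq_mul_add (D.ne_zero_of_deg_eq (D.deg_linear a)) f
  rw [D.deg_linear a] at hr
  have hrc : r = D.i (D.coeff r 0) := D.coeff_injective (Finsupp.ext fun n => by
    rw [coeff_i]
    rcases Nat.eq_zero_or_pos n with rfl | hn
    · rw [Finsupp.single_eq_same]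
    · rw [D.deg_lt_iff.1 hr n hn, Finsupp.single_eq_of_ne (by omega)])
  have hrv : r • v = 0 := by
    have h1 : (q * (D.t - D.i a) + r) • v = 0 := by
      rw [← hq, hv, ← map_smul, Cyc.smul_gen_self, map_zero]
    rwa [add_smul, mul_smul, sub_smul, ← ha, Cyc.smul_def, sub_self, smul_zero,
      zero_add] at h1
  rw [hrc, ← Cyc.smul_def, smul_eq_zero_iff_left hv0] at hrv
  rw [hrv, map_zero] at hrc
  exact ⟨a, q, hq.trans (by rw [hrc, add_zero])⟩

end Eigenring

end DiffPolyRing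

section Splitting

variable {F B C : Type*} [Field F] [Ring B] [Algebra F B] [Field C] [Algebra F C]
  [Algebra.IsCentral F B] [IsSimpleRing B]

theorem nonempty_algEquiv_matrix_of_algHom_end {m : ℕ} (hB : Module.finrank F B = m ^ 2)
    {W : Type*} [AddCommGroup W] [Module C W] [Module.Finite C W] [Nontrivial W]
    (hW : Module.finrank C W ≤ m) (ρ : C ⊗[F] B →ₐ[C] Module.End C W) :
    Nonempty (C ⊗[F] B ≃ₐ[C] Matrix (Fin m) (Fin m) C) := by
  have hE : Module.finrank C (Module.End C W) = Module.finrank C W ^ 2 := by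
    rw [Module.finrank_linearMap, sq]
  have hbij := bijective_of_tensorProduct_centralSimple ρ
    (by rw [hE, hB]; exact Nat.pow_le_pow_left hW 2)
  have e := AlgEquiv.ofBijective ρ hbij
  have hW' : Module.finrank C W = m := by
    have h := e.toLinearEquiv.finrank_eq
    rw [Module.finrank_baseChange, hB, hE] at h
    exact (Nat.pow_left_injective two_ne_zero h).symm
  exact ⟨e.trans (algEquivMatrix (Module.finBasisOfFinrankEq C W hW'))⟩

theorem nonempty_algEquiv_matrix_of_algHom_end_op {m : ℕ} (hB : Module.finrank F B = m ^ 2)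
    {W : Type*} [AddCommGroup W] [Module C W] [Module.Finite C W] [Nontrivial W]
    (hW : Module.finrank C W ≤ m) (ρ : C ⊗[F] B →ₐ[C] (Module.End C W)ᵐᵒᵖ) :
    Nonempty (C ⊗[F] B ≃ₐ[C] Matrix (Fin m) (Fin m) C) := by
  let e := (algEquivMatrix (Module.finBasis C W)).op.trans (Matrix.transposeAlgEquiv _ C C).symm
  have hw : 0 < Module.finrank C W := Module.finrank_pos
  have : Nonempty (Fin (Module.finrank C W)) := ⟨⟨0, hw⟩⟩
  exact nonempty_algEquiv_matrix_of_algHom_end (W := Fin (Module.finrank C W) → C) hB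
    (by rwa [Module.finrank_fin_fun])
    ((algEquivMatrix'.symm.toAlgHom.comp e.toAlgHom).comp ρ)

end Splitting

namespace DiffPolyRing

section LinearFactor

variable {L : Type} [Field L] {δ : Der L} {R : Type} [Ring R] (D : DiffPolyRing L δ R)
  {C : Type} [Field C] [Algebra C L] (f g : R) [SMulCommClass R C (D.Cyc f)]

/-- Endomorphisms of the target act on homomorphisms by composition. -/
def Cyc.postcomp :
    Module.End R (D.Cyc f) →ₐ[C] Module.End C (D.Cyc g →ₗ[R] D.Cyc f) where
  toFun φ :=
    { toFun := fun χ => φ ∘ₗ χ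
      map_add' := fun χ ψ => LinearMap.comp_add χ ψ φ
      map_smul' := fun c χ => LinearMap.ext fun v =>
        (φ.restrictScalars L).map_smul_of_tower c (χ v) }
  map_one' := rfl
  map_mul' _ _ := rfl
  map_zero' := rfl
  map_add' _ _ := rfl
  commutes' _ := rfl

/-- Endomorphisms of the source act contravariantly on homomorphisms by composition. -/
def Cyc.precomp [SMulCommClass R C (D.Cyc g)] :
    (Module.End R (D.Cyc f))ᵐᵒᵖ →ₐ[C] Module.End C (D.Cyc f →ₗ[R] D.Cyc g) where
  toFun φ :=
    { toFun := fun χ => χ ∘ₗ φ.unop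
      map_add' := fun χ ψ => LinearMap.add_comp φ.unop ψ χ
      map_smul' := fun _ _ => rfl }
  map_one' := rfl
  map_mul' _ _ := rfl
  map_zero' := LinearMap.ext fun χ => LinearMap.comp_zero χ
  map_add' φ ψ := LinearMap.ext fun χ => LinearMap.comp_add φ.unop ψ.unop χ
  commutes' c := LinearMap.ext fun χ => LinearMap.ext fun v =>
    (χ.restrictScalars L).map_smul_of_tower c v

variable {F B : Type} [Field F] [Ring B] [Algebra F B] [Algebra F C]
  [Algebra.IsCentral F B] [IsSimpleRing B]

variable {f g}

/-- A linear factor of `f` on either side splits the endomorphism ring of `R/Rf`. -/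
theorem nonempty_algEquiv_matrix_of_factor (hC : δ.HasConstants C) {m : ℕ} (hf : D.deg f = m)
    (hB : Module.finrank F B = m ^ 2) (ρ : C ⊗[F] B →ₐ[C] (Module.End R (D.Cyc f))ᵐᵒᵖ)
    {a : L} (hfg : f = (D.t - D.i a) * g ∨ f = g * (D.t - D.i a)) :
    Nonempty (C ⊗[F] B ≃ₐ[C] Matrix (Fin m) (Fin m) C) := by
  set p := D.t - D.i a
  have hp : D.deg p = (1 : ℕ) := D.deg_linear a
  have := Cyc.smulCommClass D p hC
  have hf0 := D.ne_zero_of_deg_eq hf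
  rcases hfg with h | h
  · obtain ⟨hfin, hle⟩ := Cyc.finite_hom_and_finrank_le D hC hf hp
    have hv : p • g • Cyc.gen D f = 0 := by
      rw [← mul_smul, ← h, Cyc.smul_gen_self]
    have hne : Nontrivial (D.Cyc p →ₗ[R] D.Cyc f) := by
      refine ⟨Cyc.lift D _ hv, 0, fun h0 => ?_⟩
      have h1 := LinearMap.congr_fun h0 (Cyc.gen D p)
      rw [Cyc.lift_gen, LinearMap.zero_apply, Cyc.smul_gen_eq_zero_iff] at h1
      obtain ⟨q, hq⟩ := h1
      have hg : g ≠ 0 := by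
        rintro rfl
        exact hf0 (by rw [h, mul_zero])
      obtain ⟨n, hn⟩ : ∃ n : ℕ, D.deg g = n := by
        refine Finset.max_of_nonempty (Finsupp.support_nonempty_iff.2 fun h0 => hg ?_)
        exact D.coeff_injective (h0.trans D.coeff_zero.symm)
      have h2 := D.deg_linear_mul a hn
      rw [← h, hf] at h2
      refine hg (hq.trans (D.eq_zero_of_deg_mul_lt hf0 ?_))
      rw [← hq, hn, hf, h2]
      exact_mod_cast Nat.lt_succ_self n
    exact nonempty_algEquiv_matrix_of_algHom_end_op hB (by simpa using hle)
      ((AlgHom.op (Cyc.postcomp D f p)).comp ρ)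
  · obtain ⟨hfin, hle⟩ := Cyc.finite_hom_and_finrank_le D hC hp hf
    have hv : f • Cyc.gen D p = 0 := by
      rw [h, mul_smul, Cyc.smul_gen_self, smul_zero]
    have hne : Nontrivial (D.Cyc f →ₗ[R] D.Cyc p) := by
      refine ⟨Cyc.lift D _ hv, 0, fun h0 => ?_⟩
      have h1 := LinearMap.congr_fun h0 (Cyc.gen D f)
      rw [Cyc.lift_gen, LinearMap.zero_apply, ← one_smul R (Cyc.gen D p),
        Cyc.smul_gen_eq_zero_iff] at h1
      obtain ⟨q, hq⟩ := h1
      have h2 : D.deg 1 = (0 : ℕ) := by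
        refine D.deg_eq_of (D.deg_le_iff.2 fun k hk => ?_) ?_ <;>
          rw [← map_one D.i, coeff_i]
        · rw [Finsupp.single_eq_of_ne (by omega)]
        · simp
      refine D.ne_zero_of_deg_eq h2
        (hq.trans (D.eq_zero_of_deg_mul_lt (D.ne_zero_of_deg_eq hp) ?_))
      rw [← hq, h2, hp]
      exact_mod_cast Nat.zero_lt_one
    exact nonempty_algEquiv_matrix_of_algHom_end hB (by simpa using hle)
      ((Cyc.precomp D f p).comp ρ)

end LinearFactor

section BaseChange

variable {K L : Type} [Field K] [Field L] [Algebra K L] {δK : Der K} {δL : Der L}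
  {R R' : Type} [Ring R] [Ring R'] (D : DiffPolyRing K δK R) (D' : DiffPolyRing L δL R')
  {j : R →+* R'}

theorem coeff_map (hji : ∀ a : K, j (D.i a) = D'.i (algebraMap K L a))
    (hjt : j D.t = D'.t) (x : R) (n : ℕ) : D'.coeff (j x) n = algebraMap K L (D.coeff x n) := by
  have : D'.coeff (j x) = (D.coeff x).mapRange (algebraMap K L) (map_zero _) := by
    rw [coeff_eq_iff, Finsupp.sum_mapRange_index (by simp)]
    conv_lhs => rw [D.repr' x, map_finsuppSum]
    exact Finsupp.sum_congr fun k _ => by rw [map_mul, map_pow, hji, hjt]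
  rw [this, Finsupp.mapRange_apply]

theorem deg_map (hji : ∀ a : K, j (D.i a) = D'.i (algebraMap K L a))
    (hjt : j D.t = D'.t) {x : R} {n : ℕ} (hx : D.deg x = n) : D'.deg (j x) = n := by
  refine D'.deg_eq_of (D'.deg_le_iff.2 fun k hk => ?_) ?_
  · rw [coeff_map D D' hji hjt, D.deg_le_iff.1 hx.le k hk, map_zero]
  · rw [coeff_map D D' hji hjt]
    exact (map_ne_zero _).2 (D.coeff_ne_zero_of_deg_eq hx)

variable {F C : Type} [Field F] [Field C] [Algebra F K] [Algebra F L] [Algebra F C]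
  [Algebra C L] [IsScalarTower F K L] [IsScalarTower F C L]
  {B : Type} [Ring B] [Algebra F B] {f : R} {m : ℕ}

/-- The right nucleus of `S_f` acts contravariantly on `S/Sf` for a ring extension `S`
of `R`. -/
theorem nonempty_algHom_of_rightNucPresents
    (hji : ∀ a : K, j (D.i a) = D'.i (algebraMap K L a))
    [SMulCommClass R' C (D'.Cyc (j f))] (hm : 2 ≤ m) (hf : D.deg f = m) (hB : D.RightNucPresents F f m B) :
    Nonempty (C ⊗[F] B →ₐ[C] (Module.End R' (D'.Cyc (j f)))ᵐᵒᵖ) := by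
  obtain ⟨φ, hadd, hmul, halg⟩ := hB
  have hf0 := D.ne_zero_of_deg_eq hf
  have hkill : ∀ b, j f • j (φ b) • Cyc.gen D' (j f) = 0 := fun b => by
    obtain ⟨-, q, hq⟩ := (D.mem_nucr_iff hm hf).1 (φ b).2
    rw [← mul_smul, ← map_mul, hq, map_mul, mul_smul, Cyc.smul_gen_self, smul_zero]
  let ψ : B → Module.End R' (D'.Cyc (j f)) := fun b => Cyc.lift D' _ (hkill b)
  have hψ : ∀ b, ψ b (Cyc.gen D' (j f)) = j (φ b) • Cyc.gen D' (j f) := fun b =>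
    Cyc.lift_gen D' _ _
  have hone : (φ 1 : R) = 1 := by simpa using halg 1
  let β : B →* (Module.End R' (D'.Cyc (j f)))ᵐᵒᵖ :=
    { toFun := fun b => MulOpposite.op (ψ b)
      map_one' := congrArg MulOpposite.op (Cyc.hom_ext D' (by
        rw [hψ, hone, map_one, one_smul]
        rfl))
      map_mul' := fun x y => congrArg MulOpposite.op (Cyc.hom_ext D' (by
        obtain ⟨⟨q, hq⟩, -⟩ := D.modr_spec hf0 (φ x * φ y)
        have h1 : ψ y (ψ x (Cyc.gen D' (j f))) =
            j (φ x * φ y) • Cyc.gen D' (j f) := by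
          rw [hψ, map_smul, hψ, map_mul, mul_smul]
        refine Eq.trans ?_ h1.symm
        rw [hψ, hmul, hq, map_add, map_mul, add_smul, mul_smul, Cyc.smul_gen_self, smul_zero,
          zero_add]
        rfl)) }
  refine nonempty_algHom_tensorProduct (RingHom.mk' β fun x y =>
    congrArg MulOpposite.op (Cyc.hom_ext D' ?_)) fun r =>
      congrArg MulOpposite.op (Cyc.hom_ext D' ?_)
  · change ψ (x + y) _ = ψ x _ + ψ y _
    rw [hψ, hψ, hψ, hadd, map_add, add_smul]
  · rw [hψ, halg, hji, ← IsScalarTower.algebraMap_apply, IsScalarTower.algebraMap_apply F C L]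
    rfl

end BaseChange

end DiffPolyRing

/-- With `L = K·C` a constant extension of `K` (char. zero) and
`B = Nuc_r(S_f)` a central simple algebra of degree `m` over `F`: the constant field `C`
splits `B` if and only if `f` has a left or right linear factor `t - a` over `L[t;δ]`;
and in that case the Petit algebra of `f` over `L` has right nucleus `Mat_m(C)`. -/
theorem statement_16 (F K C L : Type) [Field F] [Field K] [Field C] [Field L]
    [CharZero K] [Algebra F K] [Algebra F C] [Algebra F L] [Algebra K L] [Algebra C L]
    [IsScalarTower F K L] [IsScalarTower F C L]
    (δK : Der K) (δL : Der L) (hFK : δK.HasConstants F) (hCL : δL.HasConstants C)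
    (hext : ∀ a : K, δL.toFun (algebraMap K L a) = algebraMap K L (δK.toFun a))
    (hcomp : ∀ x : L, x ∈ Subfield.closure
      (Set.range (algebraMap K L) ∪ Set.range (algebraMap C L)))
    (R R' : Type) [Ring R] [Ring R']
    (D : DiffPolyRing K δK R) (D' : DiffPolyRing L δL R')
    (j : R →+* R') (hji : ∀ a : K, j (D.i a) = D'.i (algebraMap K L a))
    (hjt : j D.t = D'.t)
    (f : R) (m : ℕ) (hm : 2 ≤ m) (hdeg : D.deg f = (m : WithBot ℕ))
    (B : Type) [Ring B] [Algebra F B]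
    (hcentral : Algebra.IsCentral F B) (hsimple : IsSimpleRing B)
    (hdegB : Module.finrank F B = m ^ 2)
    (hpres : D.RightNucPresents F f m B) :
    (Nonempty ((C ⊗[F] B) ≃ₐ[C] Matrix (Fin m) (Fin m) C) ↔
      ∃ a : L, ∃ g : R', j f = (D'.t - D'.i a) * g ∨ j f = g * (D'.t - D'.i a)) ∧
    (Nonempty ((C ⊗[F] B) ≃ₐ[C] Matrix (Fin m) (Fin m) C) →
      D'.RightNucPresents C (j f) m (Matrix (Fin m) (Fin m) C)) := by
  have hf := DiffPolyRing.deg_map D D' hji hjt hdeg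
  have hcomm := DiffPolyRing.Cyc.smulCommClass D' (j f) hCL
  obtain ⟨ρ⟩ := DiffPolyRing.nonempty_algHom_of_rightNucPresents (C := C) D D' hji hm hdeg hpres
  obtain ⟨hfin, hle⟩ := DiffPolyRing.Cyc.finite_hom_and_finrank_le D' hCL hf hf
  have hnt : Nontrivial (D'.Cyc (j f)) := Module.nontrivial_of_finrank_pos (R := L) (by
    rw [DiffPolyRing.Cyc.finrank D' hf]
    omega)
  have hfin' : Module.Finite C (Module.End R' (D'.Cyc (j f)))ᵐᵒᵖ :=
    have : Module.Finite C (Module.End R' (D'.Cyc (j f))) := hfin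
    Module.Finite.equiv (MulOpposite.opLinearEquiv C)
  have hbij := bijective_of_tensorProduct_centralSimple ρ (by
    rw [hdegB, sq]
    exact (MulOpposite.finrank (R := C)).trans_le hle)
  let e := AlgEquiv.ofBijective ρ hbij
  refine ⟨⟨fun ⟨s⟩ => ?_, fun ⟨a, g, h⟩ =>
    DiffPolyRing.nonempty_algEquiv_matrix_of_factor D' hCL hf hdegB ρ h⟩, fun ⟨s⟩ =>
    DiffPolyRing.rightNucPresents_of_algEquiv D' hm hf (s.symm.trans e)⟩
  obtain ⟨a, g, h⟩ := DiffPolyRing.exists_right_factor_of_algEquiv D' hm hf (s.symm.trans e)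
  exact ⟨a, g, Or.inr h⟩
end

section
/- Let δ be a derivation on a field K and f ∈ K[t;δ] of degree m ≥ 2. Then the set F₀ = {a ∈ K : a∘h = h∘a for all h ∈ S_f} of elements of K commuting with all elements of the Petit algebra S_f equals the field of constants Const(δ) = {a ∈ K : δ(a) = 0}; in particular F₀ is a subfield of K and S_f is an algebra over Const(δ). -/
open scoped TensorProduct

namespace Der

variable {K : Type} [Field K] (δ : Der K)

lemma apply_zero : δ.toFun 0 = 0 := by
  simpa using δ.map_add' 0 0

lemma apply_one : δ.toFun 1 = 0 := by
  simpa using δ.leibniz' 1 1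

/-- The field of constants of a derivation. -/
def constants : Subfield K where
  carrier := {a | δ.toFun a = 0}
  zero_mem' := δ.apply_zero
  one_mem' := δ.apply_one
  add_mem' {a b} (ha : δ.toFun a = 0) (hb : δ.toFun b = 0) := by
    show δ.toFun (a + b) = 0
    rw [δ.map_add', ha, hb, add_zero]
  mul_mem' {a b} (ha : δ.toFun a = 0) (hb : δ.toFun b = 0) := by
    show δ.toFun (a * b) = 0
    rw [δ.leibniz', ha, hb, mul_zero, zero_mul, add_zero]
  neg_mem' {a} (ha : δ.toFun a = 0) := by
    show δ.toFun (-a) = 0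
    have h := δ.map_add' a (-a)
    rwa [add_neg_cancel, δ.apply_zero, ha, zero_add, eq_comm] at h
  inv_mem' a (ha : δ.toFun a = 0) := by
    show δ.toFun a⁻¹ = 0
    rcases eq_or_ne a 0 with rfl | h0
    · rw [inv_zero, δ.apply_zero]
    · have h := δ.leibniz' a a⁻¹
      rw [mul_inv_cancel₀ h0, δ.apply_one, ha, zero_mul, add_zero] at h
      exact (mul_eq_zero.1 h.symm).resolve_left h0

end Der

namespace DiffPolyRing

variable {K : Type} [Field K] {δ : Der K} {R : Type} [Ring R] (D : DiffPolyRing K δ R)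

lemma modr_eq {f x q r : R} (hx : x = q * f + r) (hr : D.deg r < D.deg f) :
    D.modr f x = r := by
  have hf : f ≠ 0 := by
    rintro rfl
    rw [D.deg_zero] at hr
    exact not_lt_bot hr
  have h := D.rightDiv f x hf
  rw [modr, dif_pos h]
  exact h.unique h.choose_spec.1 ⟨⟨q, hx⟩, hr⟩

lemma modr_eq_self {f x : R} (hx : D.deg x < D.deg f) : D.modr f x = x :=
  D.modr_eq (q := 0) (by rw [zero_mul, zero_add]) hx

lemma modr_i_mul {f : R} (hf : f ≠ 0) (a : K) (x : R) :
    D.modr f (D.i a * x) = D.i a * D.modr f x := by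
  obtain ⟨r, ⟨⟨q, hq⟩, hr⟩, -⟩ := D.rightDiv f x hf
  rw [D.modr_eq hq hr]
  refine D.modr_eq (q := D.i a * q) ?_ (D.deg_i_mul_lt a hr)
  rw [hq, mul_add, mul_assoc]

lemma coeff_i_mul_t_pow (a : K) (n : ℕ) : D.coeff (D.i a * D.t ^ n) = Finsupp.single n a :=
  (D.coeff_unique _ _ (by rw [Finsupp.sum_single_index (by simp)])).symm

lemma deg_i_mul_t_pow_lt (a : K) {n m : ℕ} (h : n < m) : D.deg (D.i a * D.t ^ n) < m := by
  rw [deg, coeff_i_mul_t_pow]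
  refine (Finset.max_mono Finsupp.support_single_subset).trans_lt ?_
  rw [Finset.max_singleton]
  exact WithBot.coe_lt_coe.2 h

lemma commute_i_of_const {a : K} (ha : δ.toFun a = 0) (x : R) : Commute (D.i a) x := by
  have ht : Commute (D.i a) D.t := by
    rw [Commute, SemiconjBy, D.t_mul, ha, map_zero, add_zero]
  rw [D.repr' x]
  refine Commute.sum_right _ _ _ fun n _ => Commute.mul_right ?_ (ht.pow_right n)
  rw [Commute, SemiconjBy, ← map_mul, ← map_mul, mul_comm]

end DiffPolyRing

/-- For any derivation `δ` on a field `K` and `f ∈ K[t;δ]` of degree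
`m ≥ 2`, the set `F₀` of elements of `K` commuting with all elements of the Petit algebra
`S_f` is exactly the field of constants `Const(δ)`; in particular `F₀` is a subfield of `K`
and the multiplication of `S_f` is `Const(δ)`-bilinear, i.e. `S_f` is an algebra over
`Const(δ)`. -/
theorem statement_18 (K : Type) [Field K] (δ : Der K)
    (R : Type) [Ring R] (D : DiffPolyRing K δ R) (f : R) (m : ℕ) (hm : 2 ≤ m)
    (hdeg : D.deg f = (m : WithBot ℕ)) :
    {a : K | ∀ h ∈ D.SfSet m, D.pmul f (D.i a) h = D.pmul f h (D.i a)} =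
      {a : K | δ.toFun a = 0} ∧
    (∃ F₀ : Subfield K, (F₀ : Set K) = {a : K | δ.toFun a = 0}) ∧
    ∀ a : K, δ.toFun a = 0 → ∀ x ∈ D.SfSet m, ∀ y ∈ D.SfSet m,
      D.pmul f (D.i a * x) y = D.i a * D.pmul f x y ∧
      D.pmul f x (D.i a * y) = D.i a * D.pmul f x y := by
  have hf : f ≠ 0 := by
    rintro rfl
    rw [D.deg_zero] at hdeg
    exact WithBot.bot_ne_coe hdeg
  have : Nontrivial R := ⟨f, 0, hf⟩
  refine ⟨Set.ext fun a => ⟨fun ha => ?_, fun ha h _ => ?_⟩, ⟨δ.constants, rfl⟩,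
    fun a ha x _ y _ => ⟨?_, ?_⟩⟩
  · have hat : D.deg (D.i a * D.t) < m := by
      simpa using D.deg_i_mul_t_pow_lt a (n := 1) (by lia : 1 < m)
    have hδ : D.deg (D.i (δ.toFun a)) < m := by
      simpa using D.deg_i_mul_t_pow_lt (δ.toFun a) (n := 0) (by lia : 0 < m)
    have ht : D.t ∈ D.SfSet m := by
      show D.deg D.t < m
      simpa using D.deg_i_mul_t_pow_lt 1 (n := 1) (by lia : 1 < m)
    have h := ha D.t ht
    rw [DiffPolyRing.pmul, DiffPolyRing.pmul, D.t_mul, D.modr_eq_self (hdeg ▸ hat),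
      D.modr_eq_self (hdeg ▸ D.deg_add_lt hat hδ), left_eq_add] at h
    exact (map_eq_zero D.i).1 h
  · rw [DiffPolyRing.pmul, DiffPolyRing.pmul, (D.commute_i_of_const ha h).eq]
  · rw [DiffPolyRing.pmul, DiffPolyRing.pmul, mul_assoc, D.modr_i_mul hf]
  · rw [DiffPolyRing.pmul, DiffPolyRing.pmul, ← mul_assoc, ← (D.commute_i_of_const ha x).eq,
      mul_assoc, D.modr_i_mul hf]
end
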